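/- arXiv:cs/0611119 — 3 statements merged into one kernel-verified Lean document; each statement's English description precedes it below -/
import Mathlib

section
/- Fix an integer n ≥ 2 and let P₀ = {2m/(2n−1) : m ∈ ℕ} ⊆ [0,∞). For every QTL(P₂,…,P_{n-1}) formula φ (in the single atomic proposition p, evaluated under the valuation P₀) there exists t₀ ≥ 0 such that the truth set of φ beyond t₀ is trivial: the set {t ∈ [0,∞) : t > t₀ and φ holds at t} equals one of the four sets {t > t₀ : t ∈ P₀}, {t > t₀ : t ∉ P₀}, {t : t > t₀}, and ∅. -/
/-- Syntax of QTL formulas over a single atomic proposition `p`, extended with the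
Pnueli modalities `P_j` of every arity `j`. -/
inductive QTLP : Type
  | top : QTLP
  | atom : QTLP
  | not : QTLP → QTLP
  | and : QTLP → QTLP → QTLP
  | until_ : QTLP → QTLP → QTLP
  | since : QTLP → QTLP → QTLP
  | diam : QTLP → QTLP
  | diamBar : QTLP → QTLP
  | pnueli : (j : ℕ) → (Fin j → QTLP) → QTLP

/-- Satisfaction over the time domain `[0,∞)`, with valuation `P` for `p`. -/
def QTLP.Sat (P : Set ℝ) : QTLP → ℝ → Prop
  | .top, _ => True
  | .atom, t => t ∈ P
  | .not φ, t => ¬ QTLP.Sat P φ t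
  | .and φ ψ, t => QTLP.Sat P φ t ∧ QTLP.Sat P ψ t
  | .until_ φ ψ, t => ∃ t₁, 0 ≤ t₁ ∧ t < t₁ ∧ QTLP.Sat P ψ t₁ ∧
      ∀ s, 0 ≤ s → t < s → s < t₁ → QTLP.Sat P φ s
  | .since φ ψ, t => ∃ t₁, 0 ≤ t₁ ∧ t₁ < t ∧ QTLP.Sat P ψ t₁ ∧
      ∀ s, 0 ≤ s → t₁ < s → s < t → QTLP.Sat P φ s
  | .diam φ, t => ∃ s, 0 ≤ s ∧ t < s ∧ s < t + 1 ∧ QTLP.Sat P φ s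
  | .diamBar φ, t => ∃ s, 0 ≤ s ∧ s < t ∧ t < s + 1 ∧ QTLP.Sat P φ s
  | .pnueli j args, t => ∃ ts : Fin j → ℝ, StrictMono ts ∧
      (∀ i, 0 ≤ ts i ∧ t < ts i ∧ ts i < t + 1) ∧
      ∀ i, QTLP.Sat P (args i) (ts i)

/-- `φ` is a formula of `QTL(P₂,…,P_n)`: every Pnueli modality occurring in `φ`
has arity `j` with `2 ≤ j ≤ n`. -/
def QTLP.ArityOK (n : ℕ) : QTLP → Prop
  | .top => True
  | .atom => True
  | .not φ => QTLP.ArityOK n φ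
  | .and φ ψ => QTLP.ArityOK n φ ∧ QTLP.ArityOK n ψ
  | .until_ φ ψ => QTLP.ArityOK n φ ∧ QTLP.ArityOK n ψ
  | .since φ ψ => QTLP.ArityOK n φ ∧ QTLP.ArityOK n ψ
  | .diam φ => QTLP.ArityOK n φ
  | .diamBar φ => QTLP.ArityOK n φ
  | .pnueli j args => 2 ≤ j ∧ j ≤ n ∧ ∀ i, QTLP.ArityOK n (args i)


/-- The valuation `P₀ = {2m/(2n−1) : m ∈ ℕ}`. -/
def P₀ (n : ℕ) : Set ℝ := {x : ℝ | ∃ m : ℕ, x = 2 * m / (2 * n - 1)}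

open Filter

/-- A predicate that, from some time on, depends only on membership in `P`. -/
def EventuallyTrivialOn (P : Set ℝ) (f : ℝ → Prop) : Prop :=
  ∃ a b : Prop, ∀ᶠ t in atTop, (f t ↔ (t ∈ P ∧ a) ∨ (t ∉ P ∧ b))

/-- The spacing `2/(2n−1)` of `P₀ n`. -/
noncomputable def spacing (n : ℕ) : ℝ := 2 / (2 * n - 1)

section spacing

variable {n : ℕ}

theorem spacing_pos (hn : 2 ≤ n) : 0 < spacing n := by
  have : (2 : ℝ) ≤ n := by exact_mod_cast hn
  exact div_pos two_pos (by linarith)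

theorem sub_half_mul_spacing (hn : 2 ≤ n) : ((n : ℝ) - 1 / 2) * spacing n = 1 := by
  have : (2 : ℝ) ≤ n := by exact_mod_cast hn
  have : (2 * n - 1 : ℝ) ≠ 0 := by linarith
  rw [spacing, mul_div_assoc', div_eq_one_iff_eq this]
  ring

theorem spacing_lt_one (hn : 2 ≤ n) : spacing n < 1 := by
  have h : (2 : ℝ) ≤ n := by exact_mod_cast hn
  nlinarith [spacing_pos hn, sub_half_mul_spacing hn]

theorem mem_P₀_iff {x : ℝ} : x ∈ P₀ n ↔ ∃ m : ℕ, x = m * spacing n := by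
  simp only [P₀, spacing, Set.mem_ofPred_eq]
  refine exists_congr fun m => ?_
  rw [show (2 * m / (2 * n - 1) : ℝ) = m * (2 / (2 * n - 1)) by ring]

theorem natCast_mul_spacing_mem_P₀ (m : ℕ) : m * spacing n ∈ P₀ n :=
  mem_P₀_iff.2 ⟨m, rfl⟩

theorem notMem_P₀_of_lt_of_lt (hn : 2 ≤ n) {m : ℕ} {x : ℝ} (h₁ : m * spacing n < x)
    (h₂ : x < (m + 1) * spacing n) : x ∉ P₀ n := by
  rw [mem_P₀_iff]
  rintro ⟨k, rfl⟩
  have hd := spacing_pos hn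
  have h₁' : m < k := by exact_mod_cast lt_of_mul_lt_mul_right h₁ hd.le
  have h₂' : k < m + 1 := by exact_mod_cast lt_of_mul_lt_mul_right h₂ hd.le
  omega

theorem exists_le_lt_spacing (hn : 2 ≤ n) {t : ℝ} (ht : 0 ≤ t) :
    ∃ m : ℕ, m * spacing n ≤ t ∧ t < (m + 1) * spacing n := by
  have hd := spacing_pos hn
  refine ⟨⌊t / spacing n⌋₊, ?_, ?_⟩
  · rw [← le_div_iff₀ hd]
    exact Nat.floor_le (by positivity)
  · rw [← div_lt_iff₀ hd]
    exact Nat.lt_floor_add_one _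

theorem exists_lt_le_spacing (hn : 2 ≤ n) {t : ℝ} (ht : 0 < t) :
    ∃ m : ℕ, m * spacing n < t ∧ t ≤ (m + 1) * spacing n := by
  obtain ⟨m, h₁, h₂⟩ := exists_le_lt_spacing hn ht.le
  rcases h₁.lt_or_eq with h | h
  · exact ⟨m, h, h₂.le⟩
  · cases m with
    | zero => simp at h; exact absurd h ht.ne
    | succ k =>
      push_cast at h
      exact ⟨k, by linarith [spacing_pos hn], h.ge⟩

end spacing

namespace EventuallyTrivialOn

variable {P : Set ℝ} {f g : ℝ → Prop} {n : ℕ}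

theorem const (a : Prop) : EventuallyTrivialOn P fun _ => a :=
  ⟨a, a, .of_forall fun t => by tauto⟩

theorem mem : EventuallyTrivialOn P (· ∈ P) :=
  ⟨True, False, .of_forall fun t => by tauto⟩

theorem not (hf : EventuallyTrivialOn P f) : EventuallyTrivialOn P fun t => ¬ f t := by
  obtain ⟨a, b, h⟩ := hf
  exact ⟨¬ a, ¬ b, h.mono fun t ht => by tauto⟩

theorem and (hf : EventuallyTrivialOn P f) (hg : EventuallyTrivialOn P g) :
    EventuallyTrivialOn P fun t => f t ∧ g t := by
  obtain ⟨a, b, hf⟩ := hf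
  obtain ⟨c, d, hg⟩ := hg
  exact ⟨a ∧ c, b ∧ d, (hf.and hg).mono fun t ht => by tauto⟩

theorem of_eventually_iff {a : Prop} (h : ∀ᶠ t in atTop, (f t ↔ a)) : EventuallyTrivialOn P f :=
  ⟨a, a, h.mono fun t ht => by tauto⟩

/-- A threshold form of eventual triviality. -/
theorem exists_threshold (hf : EventuallyTrivialOn P f) :
    ∃ a b : Prop, ∃ t₀ : ℝ, 0 ≤ t₀ ∧ ∀ t, t₀ ≤ t → (f t ↔ (t ∈ P ∧ a) ∨ (t ∉ P ∧ b)) := by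
  obtain ⟨a, b, h⟩ := hf
  obtain ⟨t₀, ht₀⟩ := (h.and (eventually_ge_atTop 0)).exists_forall_of_atTop
  exact ⟨a, b, t₀, (ht₀ t₀ le_rfl).2, fun t ht => (ht₀ t ht).1⟩

theorem until_ (hn : 2 ≤ n) (hf : EventuallyTrivialOn (P₀ n) f)
    (hg : EventuallyTrivialOn (P₀ n) g) :
    EventuallyTrivialOn (P₀ n) fun t =>
      ∃ t₁, 0 ≤ t₁ ∧ t < t₁ ∧ g t₁ ∧ ∀ s, 0 ≤ s → t < s → s < t₁ → f s := by
  obtain ⟨a, b, u, hu, hf⟩ := hf.exists_threshold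
  obtain ⟨c, d, v, hv, hg⟩ := hg.exists_threshold
  have hd := spacing_pos hn
  refine of_eventually_iff (a := b ∧ (c ∨ d)) ?_
  filter_upwards [eventually_ge_atTop u, eventually_ge_atTop v] with t htu htv
  obtain ⟨m, hm₁, hm₂⟩ := exists_le_lt_spacing hn (hu.trans htu)
  constructor
  · rintro ⟨t₁, -, ht₁, hgt, hft⟩
    refine ⟨?_, by have := (hg t₁ (by linarith)).1 hgt; tauto⟩
    obtain ⟨s, hs, hs'⟩ := exists_between (lt_min ht₁ hm₂)
    rw [lt_min_iff] at hs'
    have := (hf s (by linarith)).1 (hft s (by linarith) hs hs'.1)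
    have := notMem_P₀_of_lt_of_lt hn (hm₁.trans_lt hs) hs'.2
    tauto
  · rintro ⟨hb, hcd⟩
    have key : ∀ s, t < s → s < (m + 1) * spacing n → s ∉ P₀ n := fun s h₁ h₂ =>
      notMem_P₀_of_lt_of_lt hn (hm₁.trans_lt h₁) h₂
    rcases hcd with hc | hd'
    · refine ⟨(m + 1) * spacing n, by linarith, hm₂, (hg _ (by linarith)).2 (.inl ⟨?_, hc⟩), ?_⟩
      · exact_mod_cast natCast_mul_spacing_mem_P₀ (m + 1)
      · exact fun s _ h₁ h₂ => (hf s (by linarith)).2 (.inr ⟨key s h₁ h₂, hb⟩)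
    · obtain ⟨t₁, h, h'⟩ := exists_between hm₂
      exact ⟨t₁, by linarith, h, (hg _ (by linarith)).2 (.inr ⟨key _ h h', hd'⟩),
        fun s _ h₁ h₂ => (hf s (by linarith)).2 (.inr ⟨key s h₁ (h₂.trans h'), hb⟩)⟩

theorem since (hn : 2 ≤ n) (hf : EventuallyTrivialOn (P₀ n) f)
    (hg : EventuallyTrivialOn (P₀ n) g) :
    EventuallyTrivialOn (P₀ n) fun t =>
      ∃ t₁, 0 ≤ t₁ ∧ t₁ < t ∧ g t₁ ∧ ∀ s, 0 ≤ s → t₁ < s → s < t → f s := by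
  obtain ⟨a, b, u, hu, hf⟩ := hf.exists_threshold
  obtain ⟨c, d, v, hv, hg⟩ := hg.exists_threshold
  obtain ⟨w, huw, hvw⟩ : ∃ w, u ≤ w ∧ v ≤ w := ⟨max u v, le_max_left .., le_max_right ..⟩
  have hd := spacing_pos hn
  refine of_eventually_iff (a := b ∧ ((c ∨ d) ∨ (a ∧
    ∃ t₁, 0 ≤ t₁ ∧ t₁ < w ∧ g t₁ ∧ ∀ s, 0 ≤ s → t₁ < s → s < w → f s))) ?_
  filter_upwards [eventually_gt_atTop (w + spacing n)] with t htw
  obtain ⟨m, hm₁, hm₂⟩ := exists_lt_le_spacing hn (show 0 < t by linarith)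
  have hwm : w < m * spacing n := by linarith
  have hmP : m * spacing n ∈ P₀ n := natCast_mul_spacing_mem_P₀ m
  have key : ∀ s, m * spacing n < s → s < t → s ∉ P₀ n := fun s h₁ h₂ =>
    notMem_P₀_of_lt_of_lt hn h₁ (h₂.trans_le hm₂)
  constructor
  · rintro ⟨t₁, ht₀, ht₁, hgt, hft⟩
    refine ⟨?_, ?_⟩
    · obtain ⟨s, hs', hs⟩ := exists_between (max_lt ht₁ hm₁)
      rw [max_lt_iff] at hs'
      have := (hf s (by linarith)).1 (hft s (by linarith) hs'.1 hs)
      have := key s hs'.2 hs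
      tauto
    · rcases le_or_gt w t₁ with h | h
      · have := (hg t₁ (by linarith)).1 hgt
        tauto
      · have := (hf _ (by linarith)).1 (hft _ (by linarith) (by linarith) hm₁)
        exact .inr ⟨by tauto, t₁, ht₀, h, hgt, fun s h₀ h₁ h₂ => hft s h₀ h₁ (by linarith)⟩
  · rintro ⟨hb, (hc | hd') | ⟨ha, t₁, ht₀, ht₁, hgt, hft⟩⟩
    · exact ⟨m * spacing n, by linarith, hm₁, (hg _ (by linarith)).2 (.inl ⟨hmP, hc⟩),
        fun s _ h₁ h₂ => (hf s (by linarith)).2 (.inr ⟨key s h₁ h₂, hb⟩)⟩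
    · obtain ⟨t₁, h, h'⟩ := exists_between hm₁
      exact ⟨t₁, by linarith, h', (hg _ (by linarith)).2 (.inr ⟨key _ h h', hd'⟩),
        fun s _ h₁ h₂ => (hf s (by linarith)).2 (.inr ⟨key s (h.trans h₁) h₂, hb⟩)⟩
    · refine ⟨t₁, ht₀, by linarith, hgt, fun s h₀ h₁ h₂ => ?_⟩
      rcases le_or_gt w s with h | h
      · exact (hf s (by linarith)).2 (by tauto)
      · exact hft s h₀ h₁ h

theorem pnueli (hn : 2 ≤ n) {j : ℕ} (hj : j ≤ n - 1) {f : Fin j → ℝ → Prop}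
    (hf : ∀ i, EventuallyTrivialOn (P₀ n) (f i)) :
    EventuallyTrivialOn (P₀ n) fun t =>
      ∃ ts : Fin j → ℝ, StrictMono ts ∧ (∀ i, 0 ≤ ts i ∧ t < ts i ∧ ts i < t + 1) ∧
        ∀ i, f i (ts i) := by
  choose a b h using hf
  obtain ⟨u, hu⟩ := (eventually_all.2 h).exists_forall_of_atTop
  have hd := spacing_pos hn
  refine of_eventually_iff (a := ∀ i, a i ∨ b i) ?_
  filter_upwards [eventually_ge_atTop u, eventually_ge_atTop 0] with t htu ht
  constructor
  · rintro ⟨ts, -, hts, hfs⟩ i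
    have := (hu (ts i) (htu.trans (hts i).2.1.le) i).1 (hfs i)
    tauto
  · intro hab
    obtain ⟨m, hm₁, hm₂⟩ := exists_le_lt_spacing hn ht
    have aux : ∀ i : Fin j, ∃ s : ℝ, ((m + 1 + i : ℕ) : ℝ) * spacing n ≤ s ∧
        s ≤ ((m + 1 + i : ℕ) : ℝ) * spacing n + spacing n / 4 ∧ (s ∈ P₀ n ∧ a i ∨ s ∉ P₀ n ∧ b i) := by
      intro i
      rcases hab i with ha | hb
      · exact ⟨_, le_rfl, by linarith, .inl ⟨natCast_mul_spacing_mem_P₀ _, ha⟩⟩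
      · exact ⟨_, by linarith, le_rfl, .inr
          ⟨notMem_P₀_of_lt_of_lt hn (m := m + 1 + i) (by linarith) (by linarith), hb⟩⟩
    choose ts hl hr hP using aux
    have hlt : ∀ i, t < ts i := fun i => by
      have := hl i
      push_cast at this
      nlinarith [mul_nonneg (Nat.cast_nonneg (α := ℝ) (i : ℕ)) hd.le]
    refine ⟨ts, fun i k hik => ?_, fun i => ⟨ht.trans (hlt i).le, hlt i, ?_⟩, fun i =>
      (hu _ (htu.trans (hlt i).le) i).2 (hP i)⟩
    · have h₁ : ((i : ℕ) : ℝ) + 1 ≤ (k : ℕ) := by exact_mod_cast hik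
      have := hl k
      have := hr i
      push_cast at *
      nlinarith
    · have h₁ : ((i : ℕ) : ℝ) + 2 ≤ n := by
        have := i.2
        exact_mod_cast (by omega : (i : ℕ) + 2 ≤ n)
      have := hr i
      have := sub_half_mul_spacing hn
      push_cast at *
      nlinarith

theorem diam (hn : 2 ≤ n) (hf : EventuallyTrivialOn (P₀ n) f) :
    EventuallyTrivialOn (P₀ n) fun t => ∃ s, 0 ≤ s ∧ t < s ∧ s < t + 1 ∧ f s := by
  convert pnueli hn (j := 1) (by omega) (fun _ => hf) using 2 with t
  constructor
  · rintro ⟨s, h₀, h₁, h₂, h⟩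
    exact ⟨fun _ => s, Subsingleton.strictMono _, fun _ => ⟨h₀, h₁, h₂⟩, fun _ => h⟩
  · rintro ⟨ts, -, hts, h⟩
    exact ⟨ts 0, (hts 0).1, (hts 0).2.1, (hts 0).2.2, h 0⟩

theorem diamBar (hn : 2 ≤ n) (hf : EventuallyTrivialOn (P₀ n) f) :
    EventuallyTrivialOn (P₀ n) fun t => ∃ s, 0 ≤ s ∧ s < t ∧ t < s + 1 ∧ f s := by
  obtain ⟨a, b, u, hu, hf⟩ := hf.exists_threshold
  refine of_eventually_iff (a := a ∨ b) ?_
  filter_upwards [eventually_gt_atTop (u + 1)] with t htu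
  obtain ⟨m, hm₁, hm₂⟩ := exists_lt_le_spacing hn (show 0 < t by linarith)
  have hd := spacing_lt_one hn
  constructor
  · rintro ⟨s, -, -, hs, hfs⟩
    have := (hf s (by linarith)).1 hfs
    tauto
  · rintro (ha | hb)
    · exact ⟨m * spacing n, by linarith, hm₁, by linarith,
        (hf _ (by linarith)).2 (.inl ⟨natCast_mul_spacing_mem_P₀ m, ha⟩)⟩
    · obtain ⟨s, h, h'⟩ := exists_between hm₁
      exact ⟨s, by linarith, h', by linarith,
        (hf _ (by linarith)).2 (.inr ⟨notMem_P₀_of_lt_of_lt hn h (h'.trans_le hm₂), hb⟩)⟩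

end EventuallyTrivialOn

theorem QTLP.eventuallyTrivialOn_sat {n : ℕ} (hn : 2 ≤ n) (φ : QTLP)
    (hφ : QTLP.ArityOK (n - 1) φ) : EventuallyTrivialOn (P₀ n) (QTLP.Sat (P₀ n) φ) := by
  induction φ with
  | top => exact .const True
  | atom => exact .mem
  | not φ ih => exact (ih hφ).not
  | and φ ψ ihφ ihψ => exact (ihφ hφ.1).and (ihψ hφ.2)
  | until_ φ ψ ihφ ihψ => exact (ihφ hφ.1).until_ hn (ihψ hφ.2)
  | since φ ψ ihφ ihψ => exact (ihφ hφ.1).since hn (ihψ hφ.2)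
  | diam φ ih => exact (ih hφ).diam hn
  | diamBar φ ih => exact (ih hφ).diamBar hn
  | pnueli j args ih => exact .pnueli hn hφ.2.1 fun i => ih i (hφ.2.2 i)

/-- For `n ≥ 2`, every `QTL(P₂,…,P_{n-1})` formula, evaluated under the valuation
`P₀ = {2m/(2n−1) : m ∈ ℕ}`, is eventually equivalent to one of the four trivial
predicates `P₀`, `¬P₀`, `True`, `False`. -/
theorem QTLP_eventually_trivial_on_P₀ (n : ℕ) (hn : 2 ≤ n) (φ : QTLP)
    (hφ : QTLP.ArityOK (n - 1) φ) :
    ∃ t₀ : ℝ, 0 ≤ t₀ ∧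
      ({t : ℝ | t₀ < t ∧ QTLP.Sat (P₀ n) φ t} = {t : ℝ | t₀ < t ∧ t ∈ P₀ n} ∨
       {t : ℝ | t₀ < t ∧ QTLP.Sat (P₀ n) φ t} = {t : ℝ | t₀ < t ∧ t ∉ P₀ n} ∨
       {t : ℝ | t₀ < t ∧ QTLP.Sat (P₀ n) φ t} = {t : ℝ | t₀ < t} ∨
       {t : ℝ | t₀ < t ∧ QTLP.Sat (P₀ n) φ t} = ∅) := by
  obtain ⟨a, b, t₀, h₀, h⟩ := (QTLP.eventuallyTrivialOn_sat hn φ hφ).exists_threshold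
  refine ⟨t₀, h₀, ?_⟩
  have key : ∀ t, t₀ < t → (QTLP.Sat (P₀ n) φ t ↔ (t ∈ P₀ n ∧ a) ∨ (t ∉ P₀ n ∧ b)) :=
    fun t ht => h t ht.le
  simp only [Set.ext_iff, Set.mem_ofPred_eq, Set.mem_empty_iff_false]
  by_cases ha : a <;> by_cases hb : b
  · refine .inr (.inr (.inl fun t => ?_)); have := key t; tauto
  · refine .inl fun t => ?_; have := key t; tauto
  · refine .inr (.inl fun t => ?_); have := key t; tauto
  · refine .inr (.inr (.inr fun t => ?_)); have := key t; tauto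
end

section
/- Fix an integer n ≥ 2 and let P₀ = {2m/(2n−1) : m ∈ ℕ} ⊆ ℝ. For every even natural number k and every real t with k < t < k + 1/(2n−1), the set P₀ ∩ (t, t+1) contains at most n−1 points; and for every odd natural number k and every real t with k < t < k + 1/(2n−1), the set P₀ ∩ (t, t+1) contains at least n points. -/
/-- The set `P₀ ∩ (t, t+1)`, for `n = p + 1`, is the image under `m ↦ 2m/(2n−1)` of the set of
those `m` for which `2m` lies strictly between `(2n−1)t` and `(2n−1)(t+1)`. -/
theorem P₀_inter_Ioo_eq_image (p : ℕ) (t : ℝ) :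
    P₀ (p + 1) ∩ Set.Ioo t (t + 1) =
      (fun m : ℕ => (2 * m / (2 * p + 1) : ℝ)) ''
        {m : ℕ | t * (2 * p + 1) < 2 * m ∧ (2 * m : ℝ) < (t + 1) * (2 * p + 1)} := by
  have hN : (0 : ℝ) < 2 * p + 1 := by positivity
  have hcast : (2 * ((p + 1 : ℕ) : ℝ) - 1) = 2 * p + 1 := by push_cast; ring
  ext x
  simp only [P₀, hcast, Set.mem_inter_iff, Set.mem_ofPred_eq, Set.mem_Ioo, Set.mem_image]
  constructor
  · rintro ⟨⟨m, rfl⟩, h₁, h₂⟩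
    exact ⟨m, ⟨(lt_div_iff₀ hN).1 h₁, (div_lt_iff₀ hN).1 h₂⟩, rfl⟩
  · rintro ⟨m, ⟨h₁, h₂⟩, rfl⟩
    exact ⟨⟨m, rfl⟩, (lt_div_iff₀ hN).2 h₁, (div_lt_iff₀ hN).2 h₂⟩

theorem encard_P₀_inter_Ioo (p : ℕ) (t : ℝ) :
    (P₀ (p + 1) ∩ Set.Ioo t (t + 1)).encard =
      {m : ℕ | t * (2 * p + 1) < 2 * m ∧ (2 * m : ℝ) < (t + 1) * (2 * p + 1)}.encard := by
  have hN : (2 * p + 1 : ℝ) ≠ 0 := by positivity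
  rw [P₀_inter_Ioo_eq_image]
  refine Function.Injective.encard_image (fun a b hab => ?_) _
  have h : (2 * a : ℝ) = 2 * b := (div_left_inj' hN).1 hab
  exact_mod_cast mul_left_cancel₀ two_ne_zero h

/-- For `n ≥ 2`: for even `k` and `k < t < k + 1/(2n−1)`, the set `P₀ ∩ (t, t+1)` has at
most `n−1` points; for odd `k` and `k < t < k + 1/(2n−1)`, it has at least `n` points. -/
theorem counting_P₀_on_odd_fractions (n : ℕ) (hn : 2 ≤ n) :
    (∀ k : ℕ, Even k → ∀ t : ℝ, (k : ℝ) < t → t < (k : ℝ) + 1 / (2 * n - 1) →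
      (P₀ n ∩ Set.Ioo t (t + 1)).encard ≤ ((n - 1 : ℕ) : ℕ∞)) ∧
    (∀ k : ℕ, Odd k → ∀ t : ℝ, (k : ℝ) < t → t < (k : ℝ) + 1 / (2 * n - 1) →
      (n : ℕ∞) ≤ (P₀ n ∩ Set.Ioo t (t + 1)).encard) := by
  obtain ⟨p, rfl⟩ : ∃ p, n = p + 1 := ⟨n - 1, by omega⟩
  have hN : (0 : ℝ) < 2 * p + 1 := by positivity
  have hcast : (2 * ((p + 1 : ℕ) : ℝ) - 1) = 2 * p + 1 := by push_cast; ring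
  have scale : ∀ (k : ℕ) (t : ℝ), (k : ℝ) < t → t < (k : ℝ) + 1 / (2 * ((p + 1 : ℕ) : ℝ) - 1) →
      k * (2 * p + 1) < t * (2 * p + 1) ∧ t * (2 * p + 1) < k * (2 * p + 1) + 1 := by
    intro k t h₁ h₂
    rw [hcast] at h₂
    refine ⟨mul_lt_mul_of_pos_right h₁ hN, ?_⟩
    have h := mul_lt_mul_of_pos_right h₂ hN
    rwa [add_mul, one_div_mul_cancel hN.ne'] at h
  constructor
  · rintro k ⟨j, rfl⟩ t h₁ h₂
    obtain ⟨hl, hu⟩ := scale _ t h₁ h₂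
    rw [encard_P₀_inter_Ioo]
    have hsub : {m : ℕ | t * (2 * p + 1) < 2 * m ∧ (2 * m : ℝ) < (t + 1) * (2 * p + 1)} ⊆
        (Finset.Icc (j * (2 * p + 1) + 1) (j * (2 * p + 1) + p) : Finset ℕ) := by
      rintro m ⟨hm₁, hm₂⟩
      have e₁ : (j + j) * (2 * p + 1) < 2 * m := by exact_mod_cast hl.trans hm₁
      have e₂ : 2 * m < (j + j) * (2 * p + 1) + 1 + (2 * p + 1) := by
        have : (2 * m : ℝ) < ((j + j : ℕ) : ℝ) * (2 * p + 1) + 1 + (2 * p + 1) := by linarith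
        exact_mod_cast this
      rw [add_mul] at e₁ e₂
      simp only [Finset.coe_Icc, Set.mem_Icc]
      omega
    refine (Set.encard_le_encard hsub).trans ?_
    rw [Set.encard_coe_eq_coe_finsetCard, Nat.card_Icc]
    exact_mod_cast (by omega)
  · rintro k ⟨j, rfl⟩ t h₁ h₂
    obtain ⟨hl, hu⟩ := scale _ t h₁ h₂
    rw [encard_P₀_inter_Ioo]
    have hsub : ((Finset.Icc (j * (2 * p + 1) + p + 1) (j * (2 * p + 1) + 2 * p + 1) :
        Finset ℕ) : Set ℕ) ⊆
        {m : ℕ | t * (2 * p + 1) < 2 * m ∧ (2 * m : ℝ) < (t + 1) * (2 * p + 1)} := by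
      intro m hm
      simp only [Finset.coe_Icc, Set.mem_Icc] at hm
      obtain ⟨hm₁, hm₂⟩ := hm
      have e₁ : (j * (2 * p + 1) + p + 1 : ℝ) ≤ m := by exact_mod_cast hm₁
      have e₂ : (m : ℝ) ≤ j * (2 * p + 1) + 2 * p + 1 := by exact_mod_cast hm₂
      push_cast at hl hu
      constructor <;> linarith
    refine le_trans ?_ (Set.encard_le_encard hsub)
    rw [Set.encard_coe_eq_coe_finsetCard, Nat.card_Icc]
    exact_mod_cast (by omega)
end

section
/- There is no QTL formula φ (in a single atomic proposition p), interpreted over the full real line ℝ, such that for every valuation P ⊆ ℝ and every t ∈ ℝ, φ holds at t under the valuation P if and only if the set P ∩ (t, t+1) contains at least two points. (The counting modality C₂ is not expressible in QTL over the full real line.) -/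
/-- Syntax of QTL formulas over a single atomic proposition `p`. -/
inductive QTL : Type
  | top : QTL
  | atom : QTL
  | not : QTL → QTL
  | and : QTL → QTL → QTL
  | until_ : QTL → QTL → QTL
  | since : QTL → QTL → QTL
  | diam : QTL → QTL
  | diamBar : QTL → QTL

/-- Satisfaction of QTL formulas over the full real line `ℝ`, with valuation `P` for `p`. -/
def QTL.Sat (P : Set ℝ) : QTL → ℝ → Prop
  | .top, _ => True
  | .atom, t => t ∈ P
  | .not φ, t => ¬ QTL.Sat P φ t
  | .and φ ψ, t => QTL.Sat P φ t ∧ QTL.Sat P ψ t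
  | .until_ φ ψ, t => ∃ t₁, t < t₁ ∧ QTL.Sat P ψ t₁ ∧
      ∀ s, t < s → s < t₁ → QTL.Sat P φ s
  | .since φ ψ, t => ∃ t₁, t₁ < t ∧ QTL.Sat P ψ t₁ ∧
      ∀ s, t₁ < s → s < t → QTL.Sat P φ s
  | .diam φ, t => ∃ s, t < s ∧ s < t + 1 ∧ QTL.Sat P φ s
  | .diamBar φ, t => ∃ s, s < t ∧ t < s + 1 ∧ QTL.Sat P φ s

/-- The multiples of `3/4`. -/
def gridThreeQuarters : Set ℝ := {x | ∃ n : ℤ, x = 3 / 4 * n}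

theorem exists_next_mem_grid (t : ℝ) :
    ∃ p ∈ gridThreeQuarters, t < p ∧ p < t + 1 ∧ ∀ s, t < s → s < p → s ∉ gridThreeQuarters := by
  have h₁ := Int.floor_le (4 / 3 * t)
  have h₂ := Int.lt_floor_add_one (4 / 3 * t)
  refine ⟨3 / 4 * ((⌊4 / 3 * t⌋ + 1 : ℤ) : ℝ), ⟨_, rfl⟩, ?_, ?_, ?_⟩
  · push_cast; linarith
  · push_cast; linarith
  · rintro _ hs hp ⟨n, rfl⟩
    have h₃ : n < ⌊4 / 3 * t⌋ + 1 := by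
      have : (n : ℝ) < ((⌊4 / 3 * t⌋ + 1 : ℤ) : ℝ) := by linarith
      exact_mod_cast this
    have h₄ : (n : ℝ) ≤ ⌊4 / 3 * t⌋ := by exact_mod_cast Int.lt_add_one_iff.mp h₃
    linarith

theorem neg_mem_grid {x : ℝ} (hx : x ∈ gridThreeQuarters) : -x ∈ gridThreeQuarters := by
  obtain ⟨n, rfl⟩ := hx
  exact ⟨-n, by push_cast; ring⟩

theorem exists_prev_mem_grid (t : ℝ) :
    ∃ p ∈ gridThreeQuarters, p < t ∧ t < p + 1 ∧ ∀ s, p < s → s < t → s ∉ gridThreeQuarters := by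
  obtain ⟨p, hp, h₁, h₂, h₃⟩ := exists_next_mem_grid (-t)
  exact ⟨-p, neg_mem_grid hp, by linarith, by linarith, fun s hs hst hsP =>
    h₃ (-s) (by linarith) (by linarith) (neg_mem_grid hsP)⟩

/-- Over the valuation `gridThreeQuarters`, the truth of a formula at a point depends only on
whether the point lies in the grid. -/
theorem sat_grid_uniform (φ : QTL) : ∃ a b : Prop, ∀ t,
    (t ∈ gridThreeQuarters → (QTL.Sat gridThreeQuarters φ t ↔ a)) ∧
    (t ∉ gridThreeQuarters → (QTL.Sat gridThreeQuarters φ t ↔ b)) := by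
  induction φ with
  | top => exact ⟨True, True, fun t => by simp [QTL.Sat]⟩
  | atom => exact ⟨True, False, fun t => by simp [QTL.Sat]⟩
  | not φ ih =>
    obtain ⟨a, b, h⟩ := ih
    exact ⟨¬ a, ¬ b, fun t => ⟨fun ht => not_congr ((h t).1 ht), fun ht => not_congr ((h t).2 ht)⟩⟩
  | and φ ψ ih₁ ih₂ =>
    obtain ⟨a₁, b₁, h₁⟩ := ih₁
    obtain ⟨a₂, b₂, h₂⟩ := ih₂
    exact ⟨a₁ ∧ a₂, b₁ ∧ b₂, fun t => ⟨fun ht => and_congr ((h₁ t).1 ht) ((h₂ t).1 ht),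
      fun ht => and_congr ((h₁ t).2 ht) ((h₂ t).2 ht)⟩⟩
  | until_ φ ψ ih₁ ih₂ =>
    obtain ⟨a₁, b₁, h₁⟩ := ih₁
    obtain ⟨a₂, b₂, h₂⟩ := ih₂
    have key : ∀ t, QTL.Sat gridThreeQuarters (.until_ φ ψ) t ↔ b₁ ∧ (a₂ ∨ b₂) := by
      intro t
      obtain ⟨p, hp, htp, -, hgap⟩ := exists_next_mem_grid t
      constructor
      · rintro ⟨u, htu, hψ, hφ⟩
        obtain ⟨s, hts, hs⟩ := exists_between (lt_min htu htp)
        obtain ⟨hsu, hsp⟩ := lt_min_iff.mp hs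
        refine ⟨((h₁ s).2 (hgap s hts hsp)).1 (hφ s hts hsu), ?_⟩
        by_cases hu : u ∈ gridThreeQuarters
        · exact .inl (((h₂ u).1 hu).1 hψ)
        · exact .inr (((h₂ u).2 hu).1 hψ)
      · rintro ⟨hb, ha₂ | hb₂⟩
        · exact ⟨p, htp, ((h₂ p).1 hp).2 ha₂, fun s hts hsp => ((h₁ s).2 (hgap s hts hsp)).2 hb⟩
        · obtain ⟨u, htu, hup⟩ := exists_between htp
          exact ⟨u, htu, ((h₂ u).2 (hgap u htu hup)).2 hb₂,
            fun s hts hsu => ((h₁ s).2 (hgap s hts (hsu.trans hup))).2 hb⟩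
    exact ⟨_, _, fun t => ⟨fun _ => key t, fun _ => key t⟩⟩
  | since φ ψ ih₁ ih₂ =>
    obtain ⟨a₁, b₁, h₁⟩ := ih₁
    obtain ⟨a₂, b₂, h₂⟩ := ih₂
    have key : ∀ t, QTL.Sat gridThreeQuarters (.since φ ψ) t ↔ b₁ ∧ (a₂ ∨ b₂) := by
      intro t
      obtain ⟨p, hp, hpt, -, hgap⟩ := exists_prev_mem_grid t
      constructor
      · rintro ⟨u, hut, hψ, hφ⟩
        obtain ⟨s, hs, hst⟩ := exists_between (max_lt hut hpt)
        obtain ⟨hus, hps⟩ := max_lt_iff.mp hs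
        refine ⟨((h₁ s).2 (hgap s hps hst)).1 (hφ s hus hst), ?_⟩
        by_cases hu : u ∈ gridThreeQuarters
        · exact .inl (((h₂ u).1 hu).1 hψ)
        · exact .inr (((h₂ u).2 hu).1 hψ)
      · rintro ⟨hb, ha₂ | hb₂⟩
        · exact ⟨p, hpt, ((h₂ p).1 hp).2 ha₂, fun s hps hst => ((h₁ s).2 (hgap s hps hst)).2 hb⟩
        · obtain ⟨u, hpu, hut⟩ := exists_between hpt
          exact ⟨u, hut, ((h₂ u).2 (hgap u hpu hut)).2 hb₂,
            fun s hus hst => ((h₁ s).2 (hgap s (hpu.trans hus) hst)).2 hb⟩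
    exact ⟨_, _, fun t => ⟨fun _ => key t, fun _ => key t⟩⟩
  | diam φ ih =>
    obtain ⟨a, b, h⟩ := ih
    have key : ∀ t, QTL.Sat gridThreeQuarters (.diam φ) t ↔ a ∨ b := by
      intro t
      obtain ⟨p, hp, htp, hpt, hgap⟩ := exists_next_mem_grid t
      constructor
      · rintro ⟨s, -, -, hs⟩
        by_cases hsP : s ∈ gridThreeQuarters
        · exact .inl (((h s).1 hsP).1 hs)
        · exact .inr (((h s).2 hsP).1 hs)
      · rintro (ha | hb)
        · exact ⟨p, htp, hpt, ((h p).1 hp).2 ha⟩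
        · obtain ⟨u, htu, hup⟩ := exists_between htp
          exact ⟨u, htu, hup.trans hpt, ((h u).2 (hgap u htu hup)).2 hb⟩
    exact ⟨_, _, fun t => ⟨fun _ => key t, fun _ => key t⟩⟩
  | diamBar φ ih =>
    obtain ⟨a, b, h⟩ := ih
    have key : ∀ t, QTL.Sat gridThreeQuarters (.diamBar φ) t ↔ a ∨ b := by
      intro t
      obtain ⟨p, hp, hpt, htp, hgap⟩ := exists_prev_mem_grid t
      constructor
      · rintro ⟨s, -, -, hs⟩
        by_cases hsP : s ∈ gridThreeQuarters
        · exact .inl (((h s).1 hsP).1 hs)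
        · exact .inr (((h s).2 hsP).1 hs)
      · rintro (ha | hb)
        · exact ⟨p, hpt, htp, ((h p).1 hp).2 ha⟩
        · obtain ⟨u, hpu, hut⟩ := exists_between hpt
          exact ⟨u, hut, by linarith, ((h u).2 (hgap u hpu hut)).2 hb⟩
    exact ⟨_, _, fun t => ⟨fun _ => key t, fun _ => key t⟩⟩

theorem notMem_grid_of_pos_of_lt {t : ℝ} (h₀ : 0 < t) (h₁ : t < 3 / 4) :
    t ∉ gridThreeQuarters := by
  rintro ⟨n, rfl⟩
  have h₂ : 0 < n := by exact_mod_cast (by linarith : (0 : ℝ) < n)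
  have h₃ : n < 1 := by exact_mod_cast (by linarith : (n : ℝ) < 1)
  omega

/-- The counting modality `C₂` is not expressible in QTL over the full real line. -/
theorem C2_not_expressible_in_QTL_over_R :
    ¬ ∃ φ : QTL, ∀ (P : Set ℝ) (t : ℝ),
      (QTL.Sat P φ t ↔ 2 ≤ (P ∩ Set.Ioo t (t + 1)).encard) := by
  rintro ⟨φ, hφ⟩
  obtain ⟨a, b, h⟩ := sat_grid_uniform φ
  have hlate : QTL.Sat gridThreeQuarters φ (5 / 8) := by
    rw [hφ]
    have hsub : ({3 / 4, 3 / 2} : Set ℝ) ⊆ gridThreeQuarters ∩ Set.Ioo (5 / 8) (5 / 8 + 1) := by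
      rintro x (rfl | rfl)
      · exact ⟨⟨1, by norm_num⟩, by norm_num, by norm_num⟩
      · exact ⟨⟨2, by norm_num⟩, by norm_num, by norm_num⟩
    calc (2 : ℕ∞) = ({3 / 4, 3 / 2} : Set ℝ).encard := (Set.encard_pair (by norm_num)).symm
      _ ≤ _ := Set.encard_le_encard hsub
  have hearly : QTL.Sat gridThreeQuarters φ (1 / 4) :=
    ((h _).2 (notMem_grid_of_pos_of_lt (by norm_num) (by norm_num))).2
      (((h _).2 (notMem_grid_of_pos_of_lt (by norm_num) (by norm_num))).1 hlate)
  rw [hφ] at hearly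
  have hsub : gridThreeQuarters ∩ Set.Ioo (1 / 4) (1 / 4 + 1) ⊆ ({3 / 4} : Set ℝ) := by
    rintro _ ⟨⟨n, rfl⟩, h₁, h₂⟩
    have h₃ : 0 < n := by exact_mod_cast (by linarith : (0 : ℝ) < n)
    have h₄ : n < 2 := by exact_mod_cast (by linarith : (n : ℝ) < 2)
    obtain rfl : n = 1 := by omega
    norm_num
  have hle := hearly.trans (Set.encard_le_encard hsub)
  rw [Set.encard_singleton] at hle
  exact absurd hle (by norm_num)
end
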